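/- Let d ≥ 1. There exists an absolute constant c₂ > 0 such that for every C² ℤ^d-periodic function f : ℝ^d → ℝ with mean zero and every 1 < q < ∞, one has −∫_{[0,1]^d} (Δf)(x) |f(x)|^{q-2} f(x) dx ≥ c₂ ((q-1)/q²) ‖f‖_{L^q([0,1]^d)}^q. -/

import Mathlib

open MeasureTheory
open scoped ENNReal

noncomputable section

/-- the fundamental cell [0,1]^d -/
def cube (d : ℕ) : Set (Fin d → ℝ) := Set.univ.pi fun _ => Set.Icc (0 : ℝ) 1

/-- the Laplacian Δf = ∑_i ∂²f/∂x_i² of a function on ℝ^d -/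
def lap (d : ℕ) (f : (Fin d → ℝ) → ℝ) (x : Fin d → ℝ) : ℝ :=
  ∑ i, fderiv ℝ (fun y => fderiv ℝ f y (Pi.single i 1)) x (Pi.single i 1)

open Filter Topology

theorem integrable_of_measurable_of_abs_le {α : Type*} [MeasurableSpace α] {μ : Measure α}
    [IsFiniteMeasure μ] {f : α → ℝ} (hf : Measurable f) {M : ℝ} (hM : ∀ x, |f x| ≤ M) :
    Integrable f μ :=
  Integrable.of_bound hf.aestronglyMeasurable M (ae_of_all _ hM)

theorem abs_integral_le_of_abs_le {α : Type*} [MeasurableSpace α] {μ : Measure α}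
    [IsProbabilityMeasure μ] {f : α → ℝ} {M : ℝ} (hM : ∀ x, |f x| ≤ M) :
    |∫ x, f x ∂μ| ≤ M := by
  simpa using norm_integral_le_of_norm_le_const (μ := μ) (f := f) (ae_of_all _ hM)

theorem integral_sq_sub_sub_add {α : Type*} [MeasurableSpace α] {μ : Measure α}
    [IsProbabilityMeasure μ] {g a b : α → ℝ} (ig : Integrable g μ) (ia : Integrable a μ)
    (ib : Integrable b μ) (igg : Integrable (fun z => g z * g z) μ)
    (iaa : Integrable (fun z => a z * a z) μ) (ibb : Integrable (fun z => b z * b z) μ)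
    (iag : Integrable (fun z => a z * g z) μ) (ibg : Integrable (fun z => b z * g z) μ)
    (iab : Integrable (fun z => a z * b z) μ) (m : ℝ) :
    ∫ z, (g z - a z - b z + m) ^ 2 ∂μ
      = ∫ z, g z * g z ∂μ + ∫ z, a z * a z ∂μ + ∫ z, b z * b z ∂μ - 2 * ∫ z, a z * g z ∂μ
        - 2 * ∫ z, b z * g z ∂μ + 2 * ∫ z, a z * b z ∂μ + 2 * m * ∫ z, g z ∂μ
        - 2 * m * ∫ z, a z ∂μ - 2 * m * ∫ z, b z ∂μ + m * m := by
  have expand : ∀ z, (g z - a z - b z + m) ^ 2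
      = g z * g z + a z * a z + b z * b z - 2 * (a z * g z) - 2 * (b z * g z)
        + 2 * (a z * b z) + 2 * m * g z - 2 * m * a z - 2 * m * b z + m * m :=
    fun z => by ring
  simp only [expand]
  rw [integral_add (by fun_prop) (by fun_prop), integral_sub (by fun_prop) (by fun_prop),
    integral_sub (by fun_prop) (by fun_prop), integral_add (by fun_prop) (by fun_prop),
    integral_add (by fun_prop) (by fun_prop), integral_sub (by fun_prop) (by fun_prop),
    integral_sub (by fun_prop) (by fun_prop), integral_add (by fun_prop) (by fun_prop),
    integral_add (by fun_prop) (by fun_prop)]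
  simp only [integral_const_mul, integral_const, probReal_univ, smul_eq_mul, one_mul]

/-- The square of the second-order (interaction) component of a function of two independent
variables has nonnegative mean. -/
theorem integral_sq_marginals_le {X Y : Type*} [MeasurableSpace X] [MeasurableSpace Y]
    (μ : Measure X) (ν : Measure Y) [IsProbabilityMeasure μ] [IsProbabilityMeasure ν]
    {G : X × Y → ℝ} (hG : Measurable G) {M : ℝ} (hM : ∀ z, |G z| ≤ M) :
    ∫ x, (∫ y, G (x, y) ∂ν) ^ 2 ∂μ + ∫ y, (∫ x, G (x, y) ∂μ) ^ 2 ∂ν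
      ≤ ∫ z, G z ^ 2 ∂μ.prod ν + (∫ z, G z ∂μ.prod ν) ^ 2 := by
  set A : X → ℝ := fun x => ∫ y, G (x, y) ∂ν with hA
  set B : Y → ℝ := fun y => ∫ x, G (x, y) ∂μ with hB
  set m := ∫ z, G z ∂μ.prod ν with hm
  have mA : Measurable A := hG.stronglyMeasurable.integral_prod_right'.measurable
  have mB : Measurable B := hG.stronglyMeasurable.integral_prod_left'.measurable
  have bA : ∀ x, |A x| ≤ M := fun x => abs_integral_le_of_abs_le fun y => hM _
  have bB : ∀ y, |B y| ≤ M := fun y => abs_integral_le_of_abs_le fun x => hM _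
  have iG : Integrable G (μ.prod ν) := integrable_of_measurable_of_abs_le hG hM
  have iA : Integrable (fun z : X × Y => A z.1) (μ.prod ν) :=
    integrable_of_measurable_of_abs_le (mA.comp measurable_fst) fun z => bA _
  have iB : Integrable (fun z : X × Y => B z.2) (μ.prod ν) :=
    integrable_of_measurable_of_abs_le (mB.comp measurable_snd) fun z => bB _
  have prodInt : ∀ {u v : X × Y → ℝ}, Integrable v (μ.prod ν) → Integrable u (μ.prod ν) →
      (∀ z, |u z| ≤ M) → Integrable (fun z => u z * v z) (μ.prod ν) := fun hv hu hb =>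
    hv.bdd_mul hu.aestronglyMeasurable (ae_of_all _ hb)
  have iGG := prodInt iG iG hM
  have iAA := prodInt iA iA fun z => bA _
  have iBB := prodInt iB iB fun z => bB _
  have iAG := prodInt iG iA fun z => bA _
  have iBG := prodInt iG iB fun z => bB _
  have iAB := prodInt iB iA fun z => bA _
  have eA : ∫ z, A z.1 ∂μ.prod ν = m := by
    rw [integral_fun_fst (f := A), hm, integral_prod _ iG]; simp [hA]
  have eB : ∫ z, B z.2 ∂μ.prod ν = m := by
    rw [integral_fun_snd (f := B), hm, integral_prod_symm _ iG]; simp [hB]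
  have eAA : ∫ z, A z.1 * A z.1 ∂μ.prod ν = ∫ x, A x ^ 2 ∂μ := by
    rw [integral_fun_fst (f := fun x => A x * A x)]; simp [pow_two]
  have eBB : ∫ z, B z.2 * B z.2 ∂μ.prod ν = ∫ y, B y ^ 2 ∂ν := by
    rw [integral_fun_snd (f := fun x => B x * B x)]; simp [pow_two]
  have eAG : ∫ z, A z.1 * G z ∂μ.prod ν = ∫ x, A x ^ 2 ∂μ := by
    rw [integral_prod _ iAG]
    simp only [integral_const_mul, pow_two, hA]
  have eBG : ∫ z, B z.2 * G z ∂μ.prod ν = ∫ y, B y ^ 2 ∂ν := by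
    rw [integral_prod_symm _ iBG]
    simp only [integral_const_mul, pow_two, hB]
  have eAB : ∫ z, A z.1 * B z.2 ∂μ.prod ν = m * m := by
    rw [integral_prod_mul]
    congr 1
    · rw [← eA, integral_fun_fst (f := A)]; simp
    · rw [← eB, integral_fun_snd (f := B)]; simp
  have key : 0 ≤ ∫ z, (G z - A z.1 - B z.2 + m) ^ 2 ∂μ.prod ν :=
    integral_nonneg fun z => sq_nonneg _
  rw [integral_sq_sub_sub_add iG iA iB iGG iAA iBB iAG iBG iAB, eA, eB, eAA, eBB, eAG, eBG,
    eAB] at key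
  simp only [pow_two] at key ⊢
  linarith

theorem integral_pi_insertNth {X : Type*} [MeasurableSpace X] (μ : Measure X) [SigmaFinite μ]
    {n : ℕ} (i : Fin (n + 1)) (F : (Fin (n + 1) → X) → ℝ) :
    ∫ x, F x ∂Measure.pi (fun _ => μ)
      = ∫ z : X × (Fin n → X), F (i.insertNth z.1 z.2) ∂μ.prod (Measure.pi fun _ => μ) :=
  ((measurePreserving_piFinSuccAbove (fun _ => μ) i).symm.integral_comp' F).symm

theorem measurable_insertNth {X : Type*} [MeasurableSpace X] {n : ℕ} (i : Fin (n + 1)) :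
    Measurable fun z : X × (Fin n → X) => (i.insertNth z.1 z.2 : Fin (n + 1) → X) :=
  (MeasurableEquiv.piFinSuccAbove (fun _ => X) i).symm.measurable

/-- Resampling one coordinate of a product probability measure leaves it invariant. -/
theorem integral_integral_update {X : Type*} [MeasurableSpace X] (μ : Measure X)
    [IsProbabilityMeasure μ] {d : ℕ} (i : Fin d) {F : (Fin d → X) → ℝ}
    (hF : Measurable F) {M : ℝ} (hM : ∀ x, |F x| ≤ M) :
    ∫ x, ∫ t, F (Function.update x i t) ∂μ ∂Measure.pi (fun _ => μ)
      = ∫ x, F x ∂Measure.pi (fun _ => μ) := by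
  cases d with
  | zero => exact i.elim0
  | succ n =>
    have hint : Integrable (fun z : X × (Fin n → X) => F (i.insertNth z.1 z.2))
        (μ.prod (Measure.pi fun _ => μ)) :=
      integrable_of_measurable_of_abs_le (hF.comp (measurable_insertNth i)) fun z => hM _
    rw [integral_pi_insertNth μ i F, integral_prod_symm _ hint, integral_pi_insertNth μ i]
    simp only [Fin.update_insertNth]
    rw [integral_fun_snd (f := fun z => ∫ t, F (i.insertNth t z) ∂μ)]
    simp

/-- The Efron–Stein inequality: tensorization of the variance. -/
theorem efron_stein {X : Type*} [MeasurableSpace X] (μ : Measure X) [IsProbabilityMeasure μ]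
    (d : ℕ) {G : (Fin d → X) → ℝ} (hG : Measurable G) {M : ℝ} (hM : ∀ x, |G x| ≤ M) :
    ∫ x, G x ^ 2 ∂Measure.pi (fun _ => μ) - (∫ x, G x ∂Measure.pi (fun _ => μ)) ^ 2
      ≤ ∑ i, (∫ x, G x ^ 2 ∂Measure.pi (fun _ => μ)
        - ∫ x, (∫ t, G (Function.update x i t) ∂μ) ^ 2 ∂Measure.pi (fun _ => μ)) := by
  induction d with
  | zero =>
    have : ∀ x, G x = G default := fun x => congrArg G (Subsingleton.elim _ _)
    simp [this]
  | succ n ih =>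
    set π := Measure.pi (fun _ : Fin n => μ) with hπ
    set H : X × (Fin n → X) → ℝ := fun z => G (Fin.cons z.1 z.2) with hHdef
    have hcons : Measurable fun z : X × (Fin n → X) => (Fin.cons z.1 z.2 : Fin (n + 1) → X) := by
      simpa only [Fin.insertNth_zero'] using measurable_insertNth (0 : Fin (n + 1))
    have hH : Measurable H := hG.comp hcons
    have hHM : ∀ z, |H z| ≤ M := fun z => hM _
    have hsq : ∀ {a : ℝ}, |a| ≤ M → |a ^ 2| ≤ M ^ 2 := fun h => by
      rw [abs_pow]; exact pow_le_pow_left₀ (abs_nonneg _) h 2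
    have cons_int : ∀ F : (Fin (n + 1) → X) → ℝ, ∫ x, F x ∂Measure.pi (fun _ => μ)
        = ∫ z, F (Fin.cons z.1 z.2) ∂μ.prod π := fun F => by
      simpa only [Fin.insertNth_zero'] using integral_pi_insertNth μ 0 F
    have iH2 : Integrable (fun z => H z ^ 2) (μ.prod π) :=
      integrable_of_measurable_of_abs_le (hH.pow_const 2) fun z => hsq (hHM z)
    have mE : Measurable fun a => ∫ z, H (a, z) ∂π :=
      hH.stronglyMeasurable.integral_prod_right'.measurable
    have iE : Integrable (fun a => (∫ z, H (a, z) ∂π) ^ 2) μ :=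
      integrable_of_measurable_of_abs_le (mE.pow_const 2) fun a =>
        hsq (abs_integral_le_of_abs_le fun z => hHM _)
    have mK : ∀ i : Fin n, Measurable fun z : X × (Fin n → X) =>
        ∫ t, H (z.1, Function.update z.2 i t) ∂μ := fun i => by
      refine StronglyMeasurable.measurable (StronglyMeasurable.integral_prod_right'
        (f := fun p : (X × (Fin n → X)) × X => H (p.1.1, Function.update p.1.2 i p.2)) ?_)
      refine (hH.comp (Measurable.prodMk (by fun_prop) ?_)).stronglyMeasurable
      exact measurable_update'.comp ((measurable_snd.comp measurable_fst).prodMk measurable_snd)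
    have iK : ∀ i : Fin n, Integrable (fun z : X × (Fin n → X) =>
        (∫ t, H (z.1, Function.update z.2 i t) ∂μ) ^ 2) (μ.prod π) := fun i =>
      integrable_of_measurable_of_abs_le ((mK i).pow_const 2) fun a =>
        hsq (abs_integral_le_of_abs_le fun z => hHM _)
    have two := integral_sq_marginals_le μ π hH hHM
    have slice : ∀ a, ∫ z, H (a, z) ^ 2 ∂π - (∫ z, H (a, z) ∂π) ^ 2
        ≤ ∑ i, (∫ z, H (a, z) ^ 2 ∂π
          - ∫ z, (∫ t, H (a, Function.update z i t) ∂μ) ^ 2 ∂π) := fun a =>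
      ih (hH.comp measurable_prodMk_left) fun z => hHM _
    have iD : ∀ i : Fin n, Integrable (fun a => ∫ z, H (a, z) ^ 2 ∂π
        - ∫ z, (∫ t, H (a, Function.update z i t) ∂μ) ^ 2 ∂π) μ := fun i =>
      iH2.integral_prod_left.sub (iK i).integral_prod_left
    have avg := integral_mono (μ := μ) (iH2.integral_prod_left.sub iE)
      (integrable_finsetSum _ fun i _ => iD i) slice
    simp only [Pi.sub_apply] at avg
    rw [integral_sub iH2.integral_prod_left iE, integral_finsetSum _ fun i _ => iD i] at avg
    simp only [integral_sub iH2.integral_prod_left (iK _).integral_prod_left,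
      ← integral_prod _ iH2, ← integral_prod _ (iK _)] at avg
    rw [Fin.sum_univ_succ]
    simp only [cons_int, Fin.update_cons_zero, ← Fin.cons_update]
    rw [integral_fun_snd (f := fun z : Fin n → X => (∫ t, G (Fin.cons t z) ∂μ) ^ 2)]
    simp only [probReal_univ, one_smul]
    simp only [hHdef] at two avg ⊢
    linarith

/-- The signed power `sign u * |u| ^ a`, regularized at the origin by `ε`. -/
def regPow (a ε u : ℝ) : ℝ := u * (u ^ 2 + ε) ^ ((a - 1) / 2)

theorem measurable_regPow (a ε : ℝ) : Measurable (regPow a ε) := by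
  unfold regPow
  fun_prop

theorem regPow_zero_eps (a u : ℝ) : regPow a 0 u = u * |u| ^ (a - 1) := by
  have h : (u ^ 2) ^ ((a - 1) / 2) = |u| ^ (a - 1) := by
    rw [← sq_abs, ← Real.rpow_natCast, ← Real.rpow_mul (abs_nonneg u)]
    congr 1
    push_cast
    ring
  rw [regPow, add_zero, h]

theorem abs_regPow_zero_eps {a : ℝ} (ha : 0 < a) (u : ℝ) : |regPow a 0 u| = |u| ^ a := by
  rw [regPow_zero_eps, abs_mul, abs_of_nonneg (Real.rpow_nonneg (abs_nonneg u) _)]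
  rcases eq_or_ne u 0 with rfl | hu
  · simp [Real.zero_rpow ha.ne']
  · rw [Real.rpow_sub_one (abs_ne_zero.2 hu)]
    field_simp

theorem abs_regPow_le {a ε u M : ℝ} (ha : 0 < a) (hε : 0 ≤ ε) (hε1 : ε ≤ 1) (hu : |u| ≤ M) :
    |regPow a ε u| ≤ (M ^ 2 + 1) ^ (a / 2) := by
  rcases eq_or_ne u 0 with rfl | hu0
  · simp only [regPow, zero_mul, abs_zero]
    positivity
  have hs : 0 < u ^ 2 + ε := by positivity
  have hsqrt : |u| ≤ (u ^ 2 + ε) ^ (1 / 2 : ℝ) := by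
    rw [← Real.sqrt_eq_rpow]
    exact Real.abs_le_sqrt (by linarith)
  calc |regPow a ε u| = |u| * (u ^ 2 + ε) ^ ((a - 1) / 2) := by
        rw [regPow, abs_mul, abs_of_nonneg (Real.rpow_nonneg hs.le _)]
    _ ≤ (u ^ 2 + ε) ^ (1 / 2 : ℝ) * (u ^ 2 + ε) ^ ((a - 1) / 2) := by gcongr
    _ = (u ^ 2 + ε) ^ (a / 2) := by rw [← Real.rpow_add hs]; congr 1; ring
    _ ≤ (M ^ 2 + 1) ^ (a / 2) := by
        have : u ^ 2 ≤ M ^ 2 := sq_le_sq.2 (hu.trans (le_abs_self M))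
        gcongr

theorem tendsto_regPow (a u : ℝ) :
    Tendsto (fun ε => regPow a ε u) (𝓝[>] 0) (𝓝 (regPow a 0 u)) := by
  rcases eq_or_ne u 0 with rfl | hu
  · simp [regPow]
  · refine tendsto_nhdsWithin_of_tendsto_nhds (ContinuousAt.tendsto ?_)
    unfold regPow
    refine continuousAt_const.mul (ContinuousAt.rpow_const (by fun_prop) (Or.inl ?_))
    positivity

/-- The derivative of `regPow a ε`. -/
def regPowDeriv (a ε u : ℝ) : ℝ :=
  (u ^ 2 + ε) ^ ((a - 3) / 2) * (a * u ^ 2 + ε)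

theorem hasDerivAt_regPow (a : ℝ) {ε : ℝ} (hε : 0 < ε) (u : ℝ) :
    HasDerivAt (regPow a ε) (regPowDeriv a ε u) u := by
  have hs : 0 < u ^ 2 + ε := by positivity
  have h1 : HasDerivAt (fun u : ℝ => u ^ 2 + ε) (2 * u) u := by
    simpa using (hasDerivAt_pow 2 u).add_const ε
  have h2 := (hasDerivAt_id u).mul (h1.rpow_const (p := (a - 1) / 2) (Or.inl hs.ne'))
  refine h2.congr_deriv ?_
  have e : (u ^ 2 + ε) ^ ((a - 1) / 2) = (u ^ 2 + ε) ^ ((a - 3) / 2) * (u ^ 2 + ε) := by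
    rw [← Real.rpow_add_one hs.ne']; congr 1; ring
  have e2 : (a - 1) / 2 - 1 = (a - 3) / 2 := by ring
  simp only [regPowDeriv, id, e, e2]
  ring

theorem continuous_regPowDeriv (a : ℝ) {ε : ℝ} (hε : 0 < ε) : Continuous (regPowDeriv a ε) := by
  unfold regPowDeriv
  refine Continuous.mul (Continuous.rpow_const (by fun_prop) fun u => Or.inl ?_) (by fun_prop)
  positivity

theorem regPowDeriv_sq_le {q ε : ℝ} (hq : 1 < q) (hε : 0 < ε) (u : ℝ) :
    4 * ((q - 1) / q ^ 2) * regPowDeriv (q / 2) ε u ^ 2 ≤ regPowDeriv (q - 1) ε u := by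
  have hs : 0 < u ^ 2 + ε := by positivity
  have e1 : ((u ^ 2 + ε) ^ ((q / 2 - 3) / 2)) ^ 2 = (u ^ 2 + ε) ^ ((q - 6) / 2) := by
    rw [← Real.rpow_natCast, ← Real.rpow_mul hs.le]; congr 1; push_cast; ring
  have e2 : (u ^ 2 + ε) ^ ((q - 1 - 3) / 2) = (u ^ 2 + ε) ^ ((q - 6) / 2) * (u ^ 2 + ε) := by
    rw [← Real.rpow_add_one hs.ne']; congr 1; ring
  have hP : 0 < (u ^ 2 + ε) ^ ((q - 6) / 2) := Real.rpow_pos_of_pos hs _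
  have hq0 : 0 < q ^ 2 := by positivity
  rw [regPowDeriv, regPowDeriv, mul_pow, e1, e2]
  have core : 4 * ((q - 1) / q ^ 2) * (q / 2 * u ^ 2 + ε) ^ 2
      ≤ (u ^ 2 + ε) * ((q - 1) * u ^ 2 + ε) := by
    have : 4 * ((q - 1) / q ^ 2) * (q / 2 * u ^ 2 + ε) ^ 2
        = 4 * (q - 1) * (q / 2 * u ^ 2 + ε) ^ 2 / q ^ 2 := by ring
    rw [this, div_le_iff₀ hq0]
    have h1 : 0 ≤ u ^ 2 * ε * (q * (q - 2) ^ 2) := by positivity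
    have h2 : 0 ≤ ε ^ 2 * (q - 2) ^ 2 := by positivity
    nlinarith
  nlinarith [mul_le_mul_of_nonneg_left core hP.le]

theorem regPow_energy_of_pos {u u' u'' : ℝ → ℝ} (hu : ∀ t, HasDerivAt u (u' t) t)
    (hu' : ∀ t, HasDerivAt u' (u'' t) t) (hc : Continuous u'') (h0 : u 1 = u 0)
    (h1 : u' 1 = u' 0) {q ε : ℝ} (hq : 1 < q) (hε : 0 < ε) {t : ℝ} (ht : t ∈ Set.Icc (0 : ℝ) 1) :
    4 * ((q - 1) / q ^ 2) * (regPow (q / 2) ε (u t) - regPow (q / 2) ε (u 0)) ^ 2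
      ≤ -∫ s in (0 : ℝ)..1, u'' s * regPow (q - 1) ε (u s) := by
  have cu : Continuous u := continuous_iff_continuousAt.2 fun t => (hu t).continuousAt
  have cu' : Continuous u' := continuous_iff_continuousAt.2 fun t => (hu' t).continuousAt
  have cw : Continuous fun s => regPowDeriv (q / 2) ε (u s) * u' s :=
    ((continuous_regPowDeriv _ hε).comp cu).mul cu'
  have cφ : Continuous fun s => regPowDeriv (q - 1) ε (u s) * u' s :=
    ((continuous_regPowDeriv _ hε).comp cu).mul cu'
  set w : ℝ → ℝ := fun s => regPowDeriv (q / 2) ε (u s) * u' s with hw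
  set D := regPow (q / 2) ε (u t) - regPow (q / 2) ε (u 0) with hD
  have ftc : ∫ s in (0 : ℝ)..t, w s = D :=
    intervalIntegral.integral_eq_sub_of_hasDerivAt
      (fun s _ => (hasDerivAt_regPow (q / 2) hε (u s)).comp s (hu s)) (cw.intervalIntegrable _ _)
  have hD1 : D ^ 2 ≤ ∫ s in (0 : ℝ)..t, w s ^ 2 := by
    have h := intervalIntegral.integral_mono_on (f := fun s => 2 * D * w s - D ^ 2)
      (g := fun s => w s ^ 2) (μ := volume) ht.1
      (Continuous.intervalIntegrable (by fun_prop) _ _)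
      (Continuous.intervalIntegrable (by fun_prop) _ _)
      (fun s _ => by nlinarith [sq_nonneg (w s - D)])
    rw [intervalIntegral.integral_sub (Continuous.intervalIntegrable (by fun_prop) _ _)
      (by simp), intervalIntegral.integral_const_mul, ftc] at h
    simp only [intervalIntegral.integral_const, smul_eq_mul, sub_zero] at h
    nlinarith [ht.2, sq_nonneg D]
  have hD2 : ∫ s in (0 : ℝ)..t, w s ^ 2 ≤ ∫ s in (0 : ℝ)..1, w s ^ 2 :=
    intervalIntegral.integral_mono_interval le_rfl ht.1 ht.2
      (ae_of_all _ fun s => sq_nonneg (w s))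
      (Continuous.intervalIntegrable (by fun_prop) _ _)
  have parts := intervalIntegral.integral_mul_deriv_eq_deriv_mul (a := 0) (b := 1)
    (fun s _ => (hasDerivAt_regPow (q - 1) hε (u s)).comp s (hu s)) (fun s _ => hu' s)
    (cφ.intervalIntegrable _ _) (hc.intervalIntegrable _ _)
  simp only [Function.comp, h0, h1, sub_self, zero_sub] at parts
  have comm : ∫ s in (0 : ℝ)..1, u'' s * regPow (q - 1) ε (u s)
      = ∫ s in (0 : ℝ)..1, regPow (q - 1) ε (u s) * u'' s := by simp only [mul_comm]
  rw [comm, parts, neg_neg]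
  have hk : 0 ≤ 4 * ((q - 1) / q ^ 2) := by
    have : 0 ≤ q - 1 := by linarith
    positivity
  calc 4 * ((q - 1) / q ^ 2) * D ^ 2
      ≤ 4 * ((q - 1) / q ^ 2) * ∫ s in (0 : ℝ)..1, w s ^ 2 := by gcongr; exact hD1.trans hD2
    _ = ∫ s in (0 : ℝ)..1, 4 * ((q - 1) / q ^ 2) * w s ^ 2 :=
        (intervalIntegral.integral_const_mul _ _).symm
    _ ≤ _ := by
      refine intervalIntegral.integral_mono_on zero_le_one
        (Continuous.intervalIntegrable (by fun_prop) _ _)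
        ((cφ.mul cu').intervalIntegrable _ _) fun s _ => ?_
      have := mul_le_mul_of_nonneg_right (regPowDeriv_sq_le hq hε (u s)) (sq_nonneg (u' s))
      simp only [hw]
      linarith

theorem regPow_energy {u u' u'' : ℝ → ℝ} (hu : ∀ t, HasDerivAt u (u' t) t)
    (hu' : ∀ t, HasDerivAt u' (u'' t) t) (hc : Continuous u'') (h0 : u 1 = u 0)
    (h1 : u' 1 = u' 0) {q : ℝ} (hq : 1 < q) {M : ℝ} (hM : ∀ t, |u t| ≤ M)
    {t : ℝ} (ht : t ∈ Set.Icc (0 : ℝ) 1) :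
    4 * ((q - 1) / q ^ 2) * (regPow (q / 2) 0 (u t) - regPow (q / 2) 0 (u 0)) ^ 2
      ≤ -∫ s in (0 : ℝ)..1, u'' s * regPow (q - 1) 0 (u s) := by
  have cu : Continuous u := continuous_iff_continuousAt.2 fun t => (hu t).continuousAt
  have small : ∀ᶠ ε : ℝ in 𝓝[>] 0, ε ∈ Set.Ioc (0 : ℝ) 1 := Ioc_mem_nhdsGT zero_lt_one
  have lhs : Tendsto (fun ε => 4 * ((q - 1) / q ^ 2) *
      (regPow (q / 2) ε (u t) - regPow (q / 2) ε (u 0)) ^ 2) (𝓝[>] 0)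
      (𝓝 (4 * ((q - 1) / q ^ 2) * (regPow (q / 2) 0 (u t) - regPow (q / 2) 0 (u 0)) ^ 2)) :=
    (((tendsto_regPow _ _).sub (tendsto_regPow _ _)).pow 2).const_mul _
  have rhs : Tendsto (fun ε => ∫ s in (0 : ℝ)..1, u'' s * regPow (q - 1) ε (u s)) (𝓝[>] 0)
      (𝓝 (∫ s in (0 : ℝ)..1, u'' s * regPow (q - 1) 0 (u s))) := by
    refine intervalIntegral.tendsto_integral_filter_of_dominated_convergence
      (fun s => |u'' s| * (M ^ 2 + 1) ^ ((q - 1) / 2)) ?_ ?_ ?_ ?_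
    · exact Eventually.of_forall fun ε =>
        (hc.measurable.mul ((measurable_regPow _ _).comp cu.measurable)).aestronglyMeasurable
    · filter_upwards [small] with ε hε
      refine ae_of_all _ fun s _ => ?_
      rw [Real.norm_eq_abs, abs_mul]
      gcongr
      exact abs_regPow_le (by linarith) hε.1.le hε.2 (hM s)
    · exact Continuous.intervalIntegrable (by fun_prop) _ _
    · exact ae_of_all _ fun s _ => (tendsto_regPow _ _).const_mul _
  refine le_of_tendsto_of_tendsto lhs rhs.neg ?_
  filter_upwards [small] with ε hε
  exact regPow_energy_of_pos hu hu' hc h0 h1 hq hε.1 ht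

/-- A nonlinear Poincaré inequality for periodic functions of one variable. -/
theorem regPow_variance_le {u u' u'' : ℝ → ℝ} (hu : ∀ t, HasDerivAt u (u' t) t)
    (hu' : ∀ t, HasDerivAt u' (u'' t) t) (hc : Continuous u'') (h0 : u 1 = u 0)
    (h1 : u' 1 = u' 0) {q : ℝ} (hq : 1 < q) {M : ℝ} (hM : ∀ t, |u t| ≤ M) :
    4 * ((q - 1) / q ^ 2) * ((∫ t in Set.Icc (0 : ℝ) 1, regPow (q / 2) 0 (u t) ^ 2)
        - (∫ t in Set.Icc (0 : ℝ) 1, regPow (q / 2) 0 (u t)) ^ 2)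
      ≤ -∫ s in Set.Icc (0 : ℝ) 1, u'' s * regPow (q - 1) 0 (u s) := by
  have cu : Continuous u := continuous_iff_continuousAt.2 fun t => (hu t).continuousAt
  have : IsProbabilityMeasure (volume.restrict (Set.Icc (0 : ℝ) 1)) := ⟨by simp⟩
  set μ := volume.restrict (Set.Icc (0 : ℝ) 1) with hμ
  set G : ℝ → ℝ := fun t => regPow (q / 2) 0 (u t) with hG
  have mG : Measurable G := (measurable_regPow _ _).comp cu.measurable
  have bG : ∀ t, |G t| ≤ (M ^ 2 + 1) ^ (q / 2 / 2) := fun t =>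
    abs_regPow_le (by linarith) le_rfl zero_le_one (hM t)
  have iG : Integrable G μ := Integrable.of_bound mG.aestronglyMeasurable _ (ae_of_all _ bG)
  have iG2 : Integrable (fun t => G t ^ 2) μ := by
    simp only [pow_two]
    exact iG.bdd_mul mG.aestronglyMeasurable (ae_of_all _ bG)
  set K := -∫ s in Set.Icc (0 : ℝ) 1, u'' s * regPow (q - 1) 0 (u s) with hK
  have hk : 0 ≤ 4 * ((q - 1) / q ^ 2) := by
    have : 0 ≤ q - 1 := by linarith
    positivity
  have expand : ∫ t, (G t - G 0) ^ 2 ∂μ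
      = ∫ t, G t ^ 2 ∂μ - 2 * G 0 * ∫ t, G t ∂μ + G 0 ^ 2 := by
    have e : ∀ t, (G t - G 0) ^ 2 = G t ^ 2 - 2 * G 0 * G t + G 0 ^ 2 := fun t => by ring
    simp only [e]
    have iS : Integrable (fun t => G t ^ 2 - 2 * G 0 * G t) μ := iG2.sub (iG.const_mul _)
    rw [integral_add iS (integrable_const _), integral_sub iG2 (iG.const_mul _),
      integral_const_mul]
    simp
  have point : ∫ t, 4 * ((q - 1) / q ^ 2) * (G t - G 0) ^ 2 ∂μ ≤ ∫ _, K ∂μ := by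
    refine integral_mono_of_nonneg (ae_of_all _ fun t => by positivity) (integrable_const _) ?_
    filter_upwards [ae_restrict_mem measurableSet_Icc] with t ht
    rw [hK, integral_Icc_eq_integral_Ioc, ← intervalIntegral.integral_of_le zero_le_one]
    exact regPow_energy hu hu' hc h0 h1 hq hM ht
  rw [integral_const_mul, expand] at point
  simp only [integral_const, probReal_univ, smul_eq_mul, one_mul] at point
  refine le_trans (mul_le_mul_of_nonneg_left ?_ hk) point
  nlinarith [sq_nonneg (∫ t, G t ∂μ - G 0)]

theorem quarter_sub_le {a z : ℝ} (ha : 1 / 2 < a) :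
    1 / 4 - 2 * (regPow a 0 z - 1) ^ 2 ≤ z := by
  have habs := abs_regPow_zero_eps (by linarith : 0 < a) z
  rcases le_or_gt (1 / 4) z with h | h
  · nlinarith [sq_nonneg (regPow a 0 z - 1)]
  rcases le_or_gt 0 z with h0 | h0
  · have hg : 0 ≤ regPow a 0 z := by
      rw [regPow_zero_eps]; positivity
    rw [abs_of_nonneg hg, abs_of_nonneg h0] at habs
    have : regPow a 0 z ≤ 1 / 2 := by
      rw [habs]
      calc z ^ a ≤ z ^ (1 / 2 : ℝ) :=
            Real.rpow_le_rpow_of_exponent_ge' h0 (by linarith) (by norm_num) ha.le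
        _ ≤ (1 / 4) ^ (1 / 2 : ℝ) := by gcongr
        _ = 1 / 2 := by
            rw [← Real.sqrt_eq_rpow, show (1 / 4 : ℝ) = (1 / 2) ^ 2 by norm_num,
              Real.sqrt_sq (by norm_num)]
    nlinarith
  · have hg : regPow a 0 z ≤ 0 := by
      rw [regPow_zero_eps]
      exact mul_nonpos_of_nonpos_of_nonneg h0.le (by positivity)
    rw [abs_of_nonpos hg] at habs
    rcases le_or_gt |z| 1 with hz | hz
    · rw [abs_of_neg h0] at hz
      nlinarith
    · have : |z| ≤ regPow a 0 z ^ 2 := by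
        rw [← neg_sq, habs, ← Real.rpow_natCast, ← Real.rpow_mul (abs_nonneg z)]
        refine Real.self_le_rpow_of_one_le hz.le ?_
        push_cast
        linarith
      rw [abs_of_neg h0] at this
      nlinarith

theorem regPow_mul {a k : ℝ} (hk : 0 < k) (z : ℝ) :
    regPow a 0 (k * z) = k ^ a * regPow a 0 z := by
  rw [regPow_zero_eps, regPow_zero_eps, abs_mul, abs_of_pos hk,
    Real.mul_rpow hk.le (abs_nonneg z), Real.rpow_sub_one hk.ne']
  field_simp

theorem regPow_neg (a z : ℝ) : regPow a 0 (-z) = -regPow a 0 z := by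
  simp [regPow]

/-- If `f` has mean zero, the mean of its signed power is controlled by the variance. -/
theorem integral_regPow_sq_le {α : Type*} [MeasurableSpace α] {μ : Measure α}
    [IsProbabilityMeasure μ] {f : α → ℝ} {a : ℝ} (ha : 1 / 2 < a) (hf : Integrable f μ)
    (hG : Integrable (fun x => regPow a 0 (f x)) μ)
    (hG2 : Integrable (fun x => regPow a 0 (f x) ^ 2) μ) (h0 : ∫ x, f x ∂μ = 0) :
    ∫ x, regPow a 0 (f x) ^ 2 ∂μ ≤ 9 * (∫ x, regPow a 0 (f x) ^ 2 ∂μ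
      - (∫ x, regPow a 0 (f x) ∂μ) ^ 2) := by
  wlog hm : 0 ≤ ∫ x, regPow a 0 (f x) ∂μ generalizing f
  · have := this (f := fun x => -f x) hf.neg (by simp only [regPow_neg]; exact hG.neg)
      (by simpa only [regPow_neg, neg_sq] using hG2) (by rw [integral_neg, h0, neg_zero])
      (by simp only [regPow_neg, integral_neg]; linarith)
    simpa only [regPow_neg, integral_neg, neg_sq] using this
  set m := ∫ x, regPow a 0 (f x) ∂μ with hmdef
  rcases hm.eq_or_lt with h | hpos
  · rw [← h]
    have : 0 ≤ ∫ x, regPow a 0 (f x) ^ 2 ∂μ := integral_nonneg fun x => sq_nonneg _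
    linarith
  set k := m ^ (-a⁻¹) with hk
  have hk0 : 0 < k := Real.rpow_pos_of_pos hpos _
  have hka : k ^ a = m⁻¹ := by
    rw [hk, ← Real.rpow_mul hpos.le, neg_mul, inv_mul_cancel₀ (by linarith), Real.rpow_neg_one]
  have point : ∀ x, 1 / 4 - 2 * (m⁻¹ * regPow a 0 (f x) - 1) ^ 2 ≤ k * f x := fun x => by
    rw [← hka, ← regPow_mul hk0]
    exact quarter_sub_le ha
  have e : ∀ x, 1 / 4 - 2 * (m⁻¹ * regPow a 0 (f x) - 1) ^ 2
      = 4 * m⁻¹ * regPow a 0 (f x) - 2 * m⁻¹ ^ 2 * regPow a 0 (f x) ^ 2 - 7 / 4 :=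
    fun x => by ring
  simp only [e] at point
  have iS : Integrable (fun x => 4 * m⁻¹ * regPow a 0 (f x)
      - 2 * m⁻¹ ^ 2 * regPow a 0 (f x) ^ 2) μ := (hG.const_mul _).sub (hG2.const_mul _)
  have int := integral_mono (iS.sub (integrable_const _)) (hf.const_mul k) point
  simp only [Pi.sub_apply] at int
  rw [integral_sub iS (integrable_const _),
    integral_sub (hG.const_mul _) (hG2.const_mul _), integral_const_mul, integral_const_mul,
    integral_const_mul, h0, ← hmdef] at int
  simp only [integral_const, probReal_univ, smul_eq_mul, one_mul, mul_zero] at int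
  set I := ∫ x, regPow a 0 (f x) ^ 2 ∂μ
  have h1 : m⁻¹ * m = 1 := inv_mul_cancel₀ hpos.ne'
  have h2 : 9 / 4 * m ^ 2 ≤ 2 * I := by
    have := mul_le_mul_of_nonneg_right int (sq_nonneg m)
    have e2 : (4 * m⁻¹ * m - 2 * m⁻¹ ^ 2 * I - 7 / 4) * m ^ 2
      = 4 * (m⁻¹ * m) * m ^ 2 - 2 * (m⁻¹ * m) ^ 2 * I - 7 / 4 * m ^ 2 := by ring
    rw [e2, h1] at this
    linarith
  linarith

theorem exists_abs_le_of_periodic {d : ℕ} {f : (Fin d → ℝ) → ℝ} (hf : Continuous f)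
    (hper : ∀ (x : Fin d → ℝ) (n : Fin d → ℤ), f (x + fun i => (n i : ℝ)) = f x) :
    ∃ M, ∀ x, |f x| ≤ M := by
  have hc : IsCompact (cube d) := isCompact_univ_pi fun _ => isCompact_Icc
  obtain ⟨M, hM⟩ := hc.exists_bound_of_continuousOn hf.continuousOn
  refine ⟨M, fun x => ?_⟩
  have hx : f x = f (fun i => Int.fract (x i)) := by
    rw [← hper (fun i => Int.fract (x i)) fun i => ⌊x i⌋]
    congr 1
    ext i
    exact (Int.fract_add_floor (x i)).symm
  rw [hx]
  exact hM _ fun i _ => ⟨Int.fract_nonneg _, (Int.fract_lt_one _).le⟩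

theorem volume_restrict_cube (d : ℕ) :
    (volume : Measure (Fin d → ℝ)).restrict (cube d)
      = Measure.pi fun _ => volume.restrict (Set.Icc (0 : ℝ) 1) := by
  rw [cube, volume_pi, Measure.restrict_pi_pi]

theorem fderiv_periodic {d : ℕ} {f : (Fin d → ℝ) → ℝ}
    (hper : ∀ (x : Fin d → ℝ) (n : Fin d → ℤ), f (x + fun i => (n i : ℝ)) = f x)
    (v x : Fin d → ℝ) (n : Fin d → ℤ) :
    fderiv ℝ f (x + fun i => (n i : ℝ)) v = fderiv ℝ f x v := by
  rw [← fderiv_comp_add_right]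
  simp only [hper]

theorem update_one_eq_of_periodic {d : ℕ} {f : (Fin d → ℝ) → ℝ}
    (hper : ∀ (x : Fin d → ℝ) (n : Fin d → ℤ), f (x + fun i => (n i : ℝ)) = f x)
    (x : Fin d → ℝ) (i : Fin d) :
    f (Function.update x i 1) = f (Function.update x i 0) := by
  rw [← hper (Function.update x i 0) (Pi.single i 1)]
  congr 1
  ext j
  rcases eq_or_ne j i with rfl | h
  · simp
  · simp [h]

theorem hasDerivAt_comp_update {d : ℕ} {f : (Fin d → ℝ) → ℝ} (hf : Differentiable ℝ f)
    (x : Fin d → ℝ) (i : Fin d) (t : ℝ) :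
    HasDerivAt (fun t => f (Function.update x i t))
      (fderiv ℝ f (Function.update x i t) (Pi.single i 1)) t :=
  (hf _).hasFDerivAt.comp_hasDerivAt t (hasDerivAt_update x i t)

/-- The one-dimensional inequality along the `i`-th coordinate, averaged over the cube. -/
theorem regPow_conditional_variance_le {d : ℕ} {f : (Fin d → ℝ) → ℝ} (hf : ContDiff ℝ 2 f)
    (hper : ∀ (x : Fin d → ℝ) (n : Fin d → ℤ), f (x + fun i => (n i : ℝ)) = f x)
    {q : ℝ} (hq : 1 < q) (i : Fin d) :
    4 * ((q - 1) / q ^ 2) * ((∫ x in cube d, regPow (q / 2) 0 (f x) ^ 2)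
        - ∫ x in cube d,
          (∫ t in Set.Icc (0 : ℝ) 1, regPow (q / 2) 0 (f (Function.update x i t))) ^ 2)
      ≤ -∫ x in cube d, fderiv ℝ (fun y => fderiv ℝ f y (Pi.single i 1)) x (Pi.single i 1)
          * regPow (q - 1) 0 (f x) := by
  rw [volume_restrict_cube]
  have : IsProbabilityMeasure (volume.restrict (Set.Icc (0 : ℝ) 1)) := ⟨by simp⟩
  set μ := volume.restrict (Set.Icc (0 : ℝ) 1) with hμ
  set f₁ : (Fin d → ℝ) → ℝ := fun y => fderiv ℝ f y (Pi.single i 1) with hf₁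
  set f₂ : (Fin d → ℝ) → ℝ := fun y => fderiv ℝ f₁ y (Pi.single i 1) with hf₂
  have c₁ : ContDiff ℝ 1 f₁ := (hf.fderiv_right (by norm_num)).clm_apply contDiff_const
  have c₂ : Continuous f₂ := (c₁.continuous_fderiv one_ne_zero).clm_apply continuous_const
  have per₁ := fderiv_periodic hper (Pi.single i 1)
  have per₂ := fderiv_periodic (f := f₁) per₁ (Pi.single i 1)
  obtain ⟨M, hM⟩ := exists_abs_le_of_periodic hf.continuous hper
  obtain ⟨N, hN⟩ := exists_abs_le_of_periodic c₂ per₂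
  have mf := hf.continuous.measurable
  have bG : ∀ x, |regPow (q / 2) 0 (f x)| ≤ (M ^ 2 + 1) ^ (q / 2 / 2) := fun x =>
    abs_regPow_le (by linarith) le_rfl zero_le_one (hM x)
  have bΦ : ∀ x, |f₂ x * regPow (q - 1) 0 (f x)| ≤ N * (M ^ 2 + 1) ^ ((q - 1) / 2) := fun x => by
    rw [abs_mul]
    exact mul_le_mul (hN x) (abs_regPow_le (by linarith) le_rfl zero_le_one (hM x))
      (abs_nonneg _) ((abs_nonneg _).trans (hN x))
  have mG : Measurable fun x => regPow (q / 2) 0 (f x) := (measurable_regPow _ _).comp mf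
  have mΦ : Measurable fun x => f₂ x * regPow (q - 1) 0 (f x) :=
    c₂.measurable.mul ((measurable_regPow _ _).comp mf)
  have bG2 : ∀ x, |regPow (q / 2) 0 (f x) ^ 2| ≤ ((M ^ 2 + 1) ^ (q / 2 / 2)) ^ 2 := fun x => by
    rw [abs_pow]; exact pow_le_pow_left₀ (abs_nonneg _) (bG x) 2
  have mU : Measurable fun p : (Fin d → ℝ) × ℝ => Function.update p.1 i p.2 := measurable_update'
  have slice : ∀ {F : (Fin d → ℝ) → ℝ}, Measurable F →
      Measurable fun x => ∫ t, F (Function.update x i t) ∂μ := fun hF =>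
    (hF.comp mU).stronglyMeasurable.integral_prod_right'.measurable
  rw [← integral_integral_update μ i (mG.pow_const 2) bG2,
    ← integral_integral_update μ i mΦ bΦ]
  have i1 := integrable_of_measurable_of_abs_le (μ := Measure.pi fun _ : Fin d => μ)
    (slice (mG.pow_const 2)) fun x => abs_integral_le_of_abs_le fun t => bG2 _
  have i2 := integrable_of_measurable_of_abs_le (μ := Measure.pi fun _ : Fin d => μ)
    ((slice mG).pow_const 2) (M := ((M ^ 2 + 1) ^ (q / 2 / 2)) ^ 2) fun x => by
      rw [abs_pow]
      exact pow_le_pow_left₀ (abs_nonneg _) (abs_integral_le_of_abs_le fun t => bG _) 2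
  have i3 := integrable_of_measurable_of_abs_le (μ := Measure.pi fun _ : Fin d => μ)
    (slice mΦ) fun x => abs_integral_le_of_abs_le fun t => bΦ _
  rw [← integral_sub i1 i2, ← integral_const_mul, ← integral_neg]
  refine integral_mono ((i1.sub i2).const_mul _) i3.neg fun x => ?_
  exact regPow_variance_le (hasDerivAt_comp_update (hf.differentiable (by norm_num)) x i)
    (hasDerivAt_comp_update (c₁.differentiable one_ne_zero) x i)
    (c₂.comp (by fun_prop)) (update_one_eq_of_periodic hper x i)
    (update_one_eq_of_periodic (f := f₁) per₁ x i) hq fun t => hM _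

theorem eLpNorm_rpow_eq_integral_regPow_sq {α : Type*} [MeasurableSpace α] {μ : Measure α}
    [IsFiniteMeasure μ] {f : α → ℝ} (hf : Measurable f) {M : ℝ} (hM : ∀ x, |f x| ≤ M)
    {q : ℝ} (hq : 0 < q) :
    (eLpNorm f (ENNReal.ofReal q) μ).toReal ^ q = ∫ x, regPow (q / 2) 0 (f x) ^ 2 ∂μ := by
  have hmem : MemLp f (ENNReal.ofReal q) μ :=
    MemLp.of_bound hf.aestronglyMeasurable M (ae_of_all _ hM)
  have e : ∀ x, ‖f x‖ ^ q = regPow (q / 2) 0 (f x) ^ 2 := fun x => by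
    rw [← sq_abs, abs_regPow_zero_eps (by linarith), ← Real.rpow_natCast,
      ← Real.rpow_mul (abs_nonneg _), Real.norm_eq_abs]
    congr 1
    push_cast
    ring
  have hI : 0 ≤ ∫ x, regPow (q / 2) 0 (f x) ^ 2 ∂μ := integral_nonneg fun x => sq_nonneg _
  rw [hmem.eLpNorm_eq_integral_rpow_norm (by simpa using hq) ENNReal.ofReal_ne_top,
    ENNReal.toReal_ofReal hq.le]
  simp only [e]
  rw [ENNReal.toReal_ofReal (by positivity), ← Real.rpow_mul hI, inv_mul_cancel₀ hq.ne',
    Real.rpow_one]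

/-- Poincaré-type inequality on the torus for the Laplacian,
with an absolute constant c₂ > 0 (independent of the dimension and of q). -/
theorem generalized_poincare_laplacian :
    ∃ c₂ : ℝ, 0 < c₂ ∧
      ∀ d : ℕ, 1 ≤ d →
      ∀ f : (Fin d → ℝ) → ℝ,
        ContDiff ℝ 2 f →
        (∀ (x : Fin d → ℝ) (n : Fin d → ℤ), f (x + fun i => (n i : ℝ)) = f x) →
        (∫ x in cube d, f x) = 0 →
      ∀ q : ℝ, 1 < q →
        -(∫ x in cube d, lap d f x * |f x| ^ (q - 2) * f x) ≥
          c₂ * ((q - 1) / q ^ 2) *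
            (eLpNorm f (ENNReal.ofReal q) (volume.restrict (cube d))).toReal ^ q := by
  refine ⟨4 / 9, by norm_num, fun d _ f hf hper h0 q hq => ?_⟩
  have : IsProbabilityMeasure (volume.restrict (Set.Icc (0 : ℝ) 1)) := ⟨by simp⟩
  have : IsProbabilityMeasure ((volume : Measure (Fin d → ℝ)).restrict (cube d)) := by
    rw [volume_restrict_cube]; infer_instance
  obtain ⟨M, hM⟩ := exists_abs_le_of_periodic hf.continuous hper
  have mf := hf.continuous.measurable
  have mG : Measurable fun x => regPow (q / 2) 0 (f x) := (measurable_regPow _ _).comp mf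
  have bG : ∀ x, |regPow (q / 2) 0 (f x)| ≤ (M ^ 2 + 1) ^ (q / 2 / 2) := fun x =>
    abs_regPow_le (by linarith) le_rfl zero_le_one (hM x)
  have bG2 : ∀ x, |regPow (q / 2) 0 (f x) ^ 2| ≤ ((M ^ 2 + 1) ^ (q / 2 / 2)) ^ 2 := fun x => by
    rw [abs_pow]; exact pow_le_pow_left₀ (abs_nonneg _) (bG x) 2
  have spread := integral_regPow_sq_le (μ := volume.restrict (cube d)) (a := q / 2) (by linarith)
    (integrable_of_measurable_of_abs_le mf hM) (integrable_of_measurable_of_abs_le mG bG)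
    (integrable_of_measurable_of_abs_le (mG.pow_const 2) bG2) h0
  have tensor := efron_stein (volume.restrict (Set.Icc (0 : ℝ) 1)) d mG bG
  rw [← volume_restrict_cube] at tensor
  have hk : 0 ≤ 4 * ((q - 1) / q ^ 2) := by
    have : 0 ≤ q - 1 := by linarith
    positivity
  have coord := Finset.sum_le_sum fun i (_ : i ∈ Finset.univ) =>
    regPow_conditional_variance_le hf hper hq i
  have lap_eq : ∫ x in cube d, lap d f x * |f x| ^ (q - 2) * f x
      = ∑ i, ∫ x in cube d, fderiv ℝ (fun y => fderiv ℝ f y (Pi.single i 1)) x (Pi.single i 1)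
          * regPow (q - 1) 0 (f x) := by
    rw [← integral_finsetSum]
    · refine integral_congr_ae (ae_of_all _ fun x => ?_)
      simp only [lap, ← Finset.sum_mul]
      rw [regPow_zero_eps, show q - 1 - 1 = q - 2 by ring]
      ring
    · intro i _
      have c₁ : ContDiff ℝ 1 fun y => fderiv ℝ f y (Pi.single i 1) :=
        (hf.fderiv_right (by norm_num)).clm_apply contDiff_const
      have c₂ := (c₁.continuous_fderiv one_ne_zero).clm_apply
        (continuous_const (y := (Pi.single i 1 : Fin d → ℝ)))
      obtain ⟨N, hN⟩ := exists_abs_le_of_periodic c₂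
        (fderiv_periodic (f := fun y => fderiv ℝ f y (Pi.single i 1))
          (fderiv_periodic hper (Pi.single i 1)) (Pi.single i 1))
      exact (integrable_of_measurable_of_abs_le ((measurable_regPow (q - 1) 0).comp mf)
        fun x => abs_regPow_le (by linarith) le_rfl zero_le_one (hM x)).bdd_mul
          c₂.aestronglyMeasurable (ae_of_all _ hN)
  rw [eLpNorm_rpow_eq_integral_regPow_sq mf hM (by linarith), lap_eq, ← Finset.sum_neg_distrib]
  rw [← Finset.mul_sum] at coord
  have := mul_le_mul_of_nonneg_left spread hk
  have := mul_le_mul_of_nonneg_left tensor hk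
  linarith

end
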